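/- Assume V ∈ C³(ℝ³; ℝ) is bounded below and V, ∇V, ∇²V, ∇³V are bounded on ℝ³. Let ε > 0 and let (r, u) with r ∈ C¹, u ∈ C² be a global solution on [0, ∞) of the effective equation ṙ = u, m(u)u̇ = −∇V(r) + ε a(u)ü + ε b(u, u̇), such that sup_{t ≥ 0} |u(t)| ≤ ū < 1 and sup_{t ≥ 0} |u̇(t)| ≤ c for some constants ū, c (possibly depending on ε). Then u̇(t) → 0, ü(t) → 0, and ∇V(r(t)) → 0 as t → ∞. -/

import Mathlib

open Real MeasureTheory Filter
open scoped RealInnerProductSpace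

noncomputable section

abbrev E3 : Type := EuclideanSpace ℝ (Fin 3)

/-- relativistic factor γ(v) = (1 - |v|²)^{-1/2} -/
def gam (v : E3) : ℝ := (Real.sqrt (1 - ‖v‖ ^ 2))⁻¹

/-- the function appearing in the square brackets of the soliton momentum -/
def phiFun (s : ℝ) : ℝ :=
  if s = 0 then 1 / 3
  else 1 / (2 * s ^ 2 * (1 - s ^ 2)) - (1 / (4 * s ^ 3)) * Real.log ((1 + s) / (1 - s))

/-- m₀(v)w = γ w + γ³ (v·w) v -/
def m0Vec (v w : E3) : E3 := gam v • w + (gam v ^ 3 * ⟪v, w⟫) • v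

/-- m_f(v)w = 3 mₑ (φ(|v|) w + |v|⁻¹ φ'(|v|)(v·w) v), equal to mₑ • w at v = 0 -/
def mfVec (me : ℝ) (v w : E3) : E3 :=
  (3 * me * phiFun ‖v‖) • w + (3 * me * ‖v‖⁻¹ * deriv phiFun ‖v‖ * ⟪v, w⟫) • v

/-- m(v) = m₀(v) + m_f(v) -/
def mVec (me : ℝ) (v w : E3) : E3 := m0Vec v w + mfVec me v w

/-- a(v)w = (e²/12π)[γ⁴ w + 4 γ⁶ (v·w) v] -/
def aVec (e : ℝ) (v w : E3) : E3 :=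
  (e ^ 2 / (12 * π)) • (gam v ^ 4 • w + (4 * gam v ^ 6 * ⟪v, w⟫) • v)

/-- b(v,w) = (e²/4π)[2γ⁶(v·w)w + γ⁶|w|²v + 6γ⁸(v·w)²v] -/
def bVec (e : ℝ) (v w : E3) : E3 :=
  (e ^ 2 / (4 * π)) •
    ((2 * gam v ^ 6 * ⟪v, w⟫) • w + (gam v ^ 6 * ‖w‖ ^ 2) • v
      + (6 * gam v ^ 8 * ⟪v, w⟫ ^ 2) • v)

/-- soliton energy ℰ_s(v), extended by ℰ_s(0) = 0 -/
def Es (me : ℝ) (v : E3) : ℝ :=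
  if ‖v‖ = 0 then 0
  else gam v - 1 + 3 * me * ((2 - ‖v‖ ^ 2) / (2 * (1 - ‖v‖ ^ 2))
    - (1 / (2 * ‖v‖)) * Real.log ((1 + ‖v‖) / (1 - ‖v‖)))

theorem hasDerivAt_phiFun {x : ℝ} (hx0 : 0 < x) (hx1 : x < 1) :
    HasDerivAt phiFun ((x ^ 2 / (1 - x ^ 2) ^ 2 + 1 / (1 - x ^ 2) - 3 * phiFun x) / x) x := by
  have h1 : 1 - x ≠ 0 := by linarith
  have h2 : 1 + x ≠ 0 := by linarith
  have h3 : 1 - x ^ 2 ≠ 0 := by nlinarith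
  have hx : x ≠ 0 := hx0.ne'
  have hd : HasDerivAt (fun s : ℝ => s) 1 x := hasDerivAt_id' x
  have hlog : HasDerivAt (fun s : ℝ => Real.log ((1 + s) / (1 - s))) (2 / (1 - x ^ 2)) x := by
    refine (((hd.const_add 1).fun_div (hd.const_sub 1) h1).log
      (div_ne_zero h2 h1)).congr_deriv ?_
    have : 1 - x ^ 2 = (1 - x) * (1 + x) := by ring
    rw [this]
    field_simp
    ring
  have hA : HasDerivAt (fun s : ℝ => 1 / (2 * s ^ 2 * (1 - s ^ 2)))
      (-(2 * x - 4 * x ^ 3) / (2 * (x ^ 2 * (1 - x ^ 2)) ^ 2)) x := by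
    simp only [one_div]
    refine ((((hd.fun_pow 2).const_mul 2).fun_mul ((hd.fun_pow 2).const_sub 1)).fun_inv
        (by positivity)).congr_deriv ?_
    field_simp
    ring
  have hB : HasDerivAt (fun s : ℝ => 1 / (4 * s ^ 3)) (-3 / (4 * x ^ 4)) x := by
    simp only [one_div]
    refine (((hd.fun_pow 3).const_mul 4).fun_inv (by positivity)).congr_deriv ?_
    field_simp
    ring
  have hmain := hA.sub (hB.mul hlog)
  refine (hmain.congr_of_eventuallyEq ?_).congr_deriv ?_
  · filter_upwards [lt_mem_nhds hx0] with s hs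
    simp [phiFun, hs.ne']
  · simp only [phiFun, hx, if_false]
    field_simp
    ring

theorem abs_phiFun_le {x : ℝ} (hx0 : 0 ≤ x) (hx1 : x < 1) :
    |phiFun x| ≤ 1 / (1 - x ^ 2) := by
  have h3 : 0 < 1 - x ^ 2 := by nlinarith
  rcases hx0.eq_or_lt with rfl | hx
  · norm_num [phiFun]
  · have hl := Real.sum_range_le_log_div hx0 hx1 1
    have hu := Real.log_div_le_sum_range_add hx0 hx1 1
    simp at hl hu
    have e1 : 1 / (2 * x ^ 2 * (1 - x ^ 2)) =
        (1 / (2 * x ^ 3)) * (x + x ^ 3 / (1 - x ^ 2)) := by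
      field_simp
      ring
    have e2 : (1 / (2 * x ^ 3)) * (x ^ 3 / (1 - x ^ 2)) = 1 / (1 - x ^ 2) / 2 := by
      field_simp
    have hp : 0 < 1 / (2 * x ^ 3) := by positivity
    have hq : 0 < 1 / (1 - x ^ 2) := by positivity
    have e3 : phiFun x = (1 / (2 * x ^ 3)) *
        (x + x ^ 3 / (1 - x ^ 2) - 2⁻¹ * Real.log ((1 + x) / (1 - x))) := by
      rw [phiFun, if_neg hx.ne', e1]
      field_simp
      ring
    rw [e3, abs_of_nonneg (mul_nonneg hp.le (by linarith))]
    calc _ ≤ (1 / (2 * x ^ 3)) * (x ^ 3 / (1 - x ^ 2)) :=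
          mul_le_mul_of_nonneg_left (by linarith) hp.le
      _ ≤ _ := by rw [e2]; linarith

/-- The energy of the comoving field of a charge with velocity `v`, per unit of `3 * me`. -/
def fieldEnergy (v : E3) : ℝ := ‖v‖ ^ 2 * (2 * phiFun ‖v‖ - 1 / (2 * (1 - ‖v‖ ^ 2)))

theorem abs_fieldEnergy_le {v : E3} {R : ℝ} (hR : R < 1) (hv : ‖v‖ ≤ R) :
    |fieldEnergy v| ≤ 3 / (1 - R ^ 2) * ‖v‖ ^ 2 := by
  have hv0 := norm_nonneg v
  have hs : ‖v‖ ^ 2 ≤ R ^ 2 := by gcongr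
  have hR2 : 0 < 1 - R ^ 2 := by nlinarith
  have h1 := abs_phiFun_le hv0 (hv.trans_lt hR)
  have h2 : 1 / (1 - ‖v‖ ^ 2) ≤ 1 / (1 - R ^ 2) := by gcongr
  have h3 : 1 / (2 * (1 - ‖v‖ ^ 2)) = 1 / (1 - ‖v‖ ^ 2) / 2 := by
    rw [div_div, mul_comm]
  have h4 : 0 < 1 / (1 - ‖v‖ ^ 2) := by
    have : 0 < 1 - ‖v‖ ^ 2 := by linarith
    positivity
  have h5 : 3 / (1 - R ^ 2) = 3 * (1 / (1 - R ^ 2)) := by ring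
  rw [fieldEnergy, abs_mul, abs_of_nonneg (by positivity : 0 ≤ ‖v‖ ^ 2), mul_comm, h3, h5]
  refine mul_le_mul_of_nonneg_right ?_ (by positivity)
  rw [abs_le] at h1 ⊢
  constructor <;> linarith [h1.1, h1.2]

theorem HasDerivWithinAt.norm_of_ne_zero {u : ℝ → E3} {w : E3} {s : Set ℝ} {t : ℝ}
    (hu : HasDerivWithinAt u w s t) (h0 : u t ≠ 0) :
    HasDerivWithinAt (fun τ => ‖u τ‖) (⟪u t, w⟫ / ‖u t‖) s t := by
  have hn : ‖u t‖ ≠ 0 := norm_ne_zero_iff.2 h0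
  have := hu.norm_sq.sqrt (by positivity)
  simp only [Real.sqrt_sq (norm_nonneg _)] at this
  refine this.congr_deriv ?_
  field_simp

theorem HasDerivWithinAt.fieldEnergy {u : ℝ → E3} {w : E3} {s : Set ℝ} {t : ℝ}
    (hu : HasDerivWithinAt u w s t) (h1 : ‖u t‖ < 1) :
    HasDerivWithinAt (fun τ => fieldEnergy (u τ))
      ((phiFun ‖u t‖ + ‖u t‖ * deriv phiFun ‖u t‖) * ⟪u t, w⟫) s t := by
  by_cases h0 : u t = 0
  · have hO : HasFDerivAt _root_.fieldEnergy (0 : E3 →L[ℝ] ℝ) (u t) := by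
      rw [h0]
      refine Asymptotics.IsBigO.hasFDerivAt (n := 2) ?_ one_lt_two
      refine Asymptotics.IsBigO.of_bound (3 / (1 - (1 / 2 : ℝ) ^ 2)) ?_
      filter_upwards [Metric.closedBall_mem_nhds (0 : E3) (by norm_num : (0 : ℝ) < 1 / 2)] with v hv
      have := abs_fieldEnergy_le (by norm_num) (mem_closedBall_zero_iff.1 hv)
      simpa using this
    exact (hO.comp_hasDerivWithinAt t hu).congr_deriv (by simp [h0])
  · have hx : 0 < ‖u t‖ := norm_pos_iff.2 h0
    have h3 : 1 - ‖u t‖ ^ 2 ≠ 0 := by nlinarith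
    have hφ := hasDerivAt_phiFun hx h1
    rw [hφ.deriv]
    have hd : HasDerivAt (fun s : ℝ => s) 1 ‖u t‖ := hasDerivAt_id' _
    have hg := (hd.fun_pow 2).fun_mul ((hφ.const_mul 2).fun_sub
      ((((hd.fun_pow 2).const_sub 1).const_mul 2).fun_inv (by positivity)))
    have := hg.comp_hasDerivWithinAt t (hu.norm_of_ne_zero h0)
    simp only [_root_.fieldEnergy, one_div]
    refine this.congr_deriv ?_
    simp
    field_simp
    ring

theorem HasDerivWithinAt.gam {u : ℝ → E3} {w : E3} {s : Set ℝ} {t : ℝ}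
    (hu : HasDerivWithinAt u w s t) (h1 : ‖u t‖ < 1) :
    HasDerivWithinAt (fun τ => gam (u τ)) (gam (u t) ^ 3 * ⟪u t, w⟫) s t := by
  have hp : 0 < 1 - ‖u t‖ ^ 2 := by nlinarith [norm_nonneg (u t)]
  have := ((hu.norm_sq.const_sub 1).sqrt hp.ne').fun_inv (Real.sqrt_pos.2 hp).ne'
  refine this.congr_deriv ?_
  have hs := (Real.sqrt_pos.2 hp).ne'
  simp only [_root_.gam]
  field_simp

theorem gam_sq {v : E3} (h1 : ‖v‖ < 1) : gam v ^ 2 * (1 - ‖v‖ ^ 2) = 1 := by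
  have hp : 0 < 1 - ‖v‖ ^ 2 := by nlinarith [norm_nonneg v]
  rw [gam, inv_pow, Real.sq_sqrt hp.le, inv_mul_cancel₀ hp.ne']

theorem one_le_gam {v : E3} (h1 : ‖v‖ < 1) : 1 ≤ gam v := by
  have hp : 0 < 1 - ‖v‖ ^ 2 := by nlinarith [norm_nonneg v]
  refine (one_le_inv₀ (Real.sqrt_pos.2 hp)).2 ?_
  rw [Real.sqrt_le_one]
  nlinarith [norm_nonneg v]

theorem gam_le {v : E3} {R : ℝ} (hR : R < 1) (hv : ‖v‖ ≤ R) :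
    gam v ≤ (Real.sqrt (1 - R ^ 2))⁻¹ := by
  have hs : ‖v‖ ^ 2 ≤ R ^ 2 := by gcongr
  have hp : 0 < 1 - R ^ 2 := by nlinarith [norm_nonneg v]
  have := Real.sqrt_pos.2 hp
  rw [gam]
  gcongr

theorem norm_inner_le_of_norm_le_one {v w : E3} (hv : ‖v‖ ≤ 1) : |⟪v, w⟫| ≤ ‖w‖ :=
  (abs_real_inner_le_norm v w).trans (mul_le_of_le_one_left (norm_nonneg w) hv)

theorem norm_aVec_le (e : ℝ) {R : ℝ} (hR : R < 1) :
    ∃ C, 0 ≤ C ∧ ∀ v w : E3, ‖v‖ ≤ R → ‖aVec e v w‖ ≤ C * ‖w‖ := by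
  set Γ := (Real.sqrt (1 - R ^ 2))⁻¹ with hΓ
  have hΓ0 : 0 ≤ Γ := by positivity
  refine ⟨e ^ 2 / (12 * π) * (Γ ^ 4 + 4 * Γ ^ 6), by positivity, fun v w hv => ?_⟩
  have hv1 : ‖v‖ < 1 := hv.trans_lt hR
  have hg1 : 0 ≤ gam v := zero_le_one.trans (one_le_gam hv1)
  have hg := gam_le hR hv
  have hp := norm_inner_le_of_norm_le_one (w := w) hv1.le
  rw [aVec, norm_smul, Real.norm_of_nonneg (by positivity), mul_assoc (e ^ 2 / (12 * π))]
  gcongr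
  refine (norm_add_le _ _).trans ?_
  rw [norm_smul, norm_smul, add_mul, norm_mul, Real.norm_of_nonneg (by positivity),
    Real.norm_of_nonneg (by positivity), Real.norm_eq_abs]
  gcongr ?_ + ?_
  · gcongr
  · refine (mul_le_of_le_one_right (by positivity) hv1.le).trans ?_
    gcongr

theorem norm_bVec_le (e : ℝ) {R : ℝ} (hR : R < 1) :
    ∃ C, 0 ≤ C ∧ ∀ v w : E3, ‖v‖ ≤ R → ‖bVec e v w‖ ≤ C * ‖w‖ ^ 2 := by
  set Γ := (Real.sqrt (1 - R ^ 2))⁻¹ with hΓ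
  have hΓ0 : 0 ≤ Γ := by positivity
  refine ⟨e ^ 2 / (4 * π) * (2 * Γ ^ 6 + Γ ^ 6 + 6 * Γ ^ 8), by positivity, fun v w hv => ?_⟩
  have hv1 : ‖v‖ < 1 := hv.trans_lt hR
  have hg1 : 0 ≤ gam v := zero_le_one.trans (one_le_gam hv1)
  have hg := gam_le hR hv
  have hp := norm_inner_le_of_norm_le_one (w := w) hv1.le
  have hp2 : ⟪v, w⟫ ^ 2 ≤ ‖w‖ ^ 2 := by
    rw [← sq_abs]
    gcongr
  rw [bVec, norm_smul, Real.norm_of_nonneg (by positivity), mul_assoc (e ^ 2 / (4 * π))]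
  gcongr
  refine (norm_add₃_le).trans ?_
  rw [norm_smul, norm_smul, norm_smul, add_mul, add_mul, norm_mul,
    Real.norm_of_nonneg (by positivity),
    Real.norm_of_nonneg (by positivity : 0 ≤ gam v ^ 6 * ‖w‖ ^ 2),
    Real.norm_of_nonneg (by positivity : 0 ≤ 6 * gam v ^ 8 * ⟪v, w⟫ ^ 2), Real.norm_eq_abs]
  gcongr ?_ + ?_ + ?_
  · rw [sq, ← mul_assoc]
    gcongr
  · refine (mul_le_of_le_one_right (by positivity) hv1.le).trans ?_
    gcongr
  · refine (mul_le_of_le_one_right (by positivity) hv1.le).trans ?_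
    gcongr

theorem abs_mul_deriv_phiFun_le {x : ℝ} (hx0 : 0 ≤ x) (hx1 : x < 1) :
    |x * deriv phiFun x| ≤ 1 / (1 - x ^ 2) ^ 2 + 4 * (1 / (1 - x ^ 2)) := by
  have h3 : 0 < 1 - x ^ 2 := by nlinarith
  have hA : 0 < 1 / (1 - x ^ 2) := by positivity
  rcases hx0.eq_or_lt with rfl | hx
  · norm_num
  · have h1 := abs_phiFun_le hx0 hx1
    rw [(hasDerivAt_phiFun hx hx1).deriv, mul_div_cancel₀ _ hx.ne']
    have h4 : x ^ 2 / (1 - x ^ 2) ^ 2 ≤ 1 / (1 - x ^ 2) ^ 2 := by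
      gcongr
      linarith
    have h5 : 0 ≤ x ^ 2 / (1 - x ^ 2) ^ 2 := by positivity
    rw [abs_le] at h1 ⊢
    constructor <;> linarith [h1.1, h1.2]

theorem norm_mVec_le {me R : ℝ} (hme : 0 ≤ me) (hR0 : 0 ≤ R) (hR : R < 1) :
    ∃ C, 0 ≤ C ∧ ∀ v w : E3, ‖v‖ ≤ R → ‖mVec me v w‖ ≤ C * ‖w‖ := by
  set Γ := (Real.sqrt (1 - R ^ 2))⁻¹ with hΓ
  have hΓ0 : 0 ≤ Γ := by positivity
  have hR2 : 0 < 1 - R ^ 2 := by nlinarith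
  refine ⟨Γ + Γ ^ 3 + (3 * me * (1 / (1 - R ^ 2)) +
    3 * me * (1 / (1 - R ^ 2) ^ 2 + 4 * (1 / (1 - R ^ 2)))), by positivity, fun v w hv => ?_⟩
  have hv1 : ‖v‖ < 1 := hv.trans_lt hR
  have hs : ‖v‖ ^ 2 ≤ R ^ 2 := by gcongr
  have hg1 : 0 ≤ gam v := zero_le_one.trans (one_le_gam hv1)
  have hg := gam_le hR hv
  have hp := norm_inner_le_of_norm_le_one (w := w) hv1.le
  have hA : 1 / (1 - ‖v‖ ^ 2) ≤ 1 / (1 - R ^ 2) := by gcongr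
  have hA2 : 1 / (1 - ‖v‖ ^ 2) ^ 2 ≤ 1 / (1 - R ^ 2) ^ 2 := by gcongr
  have hφ := (abs_phiFun_le (norm_nonneg v) hv1).trans hA
  have hφ' := (abs_mul_deriv_phiFun_le (norm_nonneg v) hv1).trans
    (add_le_add hA2 (mul_le_mul_of_nonneg_left hA zero_le_four))
  rw [mVec, m0Vec, mfVec, add_mul]
  refine (norm_add_le _ _).trans (add_le_add ((norm_add_le _ _).trans ?_)
    ((norm_add_le _ _).trans ?_))
  · rw [norm_smul, norm_smul, add_mul, norm_mul, Real.norm_of_nonneg (by positivity),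
      Real.norm_of_nonneg (by positivity), Real.norm_eq_abs]
    gcongr ?_ + ?_
    · gcongr
    · refine (mul_le_of_le_one_right (by positivity) hv1.le).trans ?_
      gcongr
  · rw [norm_smul, norm_smul, add_mul]
    gcongr ?_ + ?_
    · rw [norm_mul, Real.norm_of_nonneg (by positivity), Real.norm_eq_abs]
      gcongr
    · rcases eq_or_ne v 0 with rfl | h0
      · simp only [norm_zero, mul_zero]
        positivity
      · have hn : 0 < ‖v‖ := norm_pos_iff.2 h0
        have hcs := abs_real_inner_le_norm v w
        calc ‖3 * me * ‖v‖⁻¹ * deriv phiFun ‖v‖ * ⟪v, w⟫‖ * ‖v‖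
            = 3 * me * (|deriv phiFun ‖v‖| * |⟪v, w⟫|) := by
              simp only [norm_mul, Real.norm_eq_abs, abs_of_nonneg hme, norm_inv, abs_norm,
                abs_of_pos (zero_lt_three' ℝ)]
              field_simp
          _ ≤ 3 * me * (|deriv phiFun ‖v‖| * (‖v‖ * ‖w‖)) := by gcongr
          _ = 3 * me * |‖v‖ * deriv phiFun ‖v‖| * ‖w‖ := by
              rw [abs_mul, abs_norm]
              ring
          _ ≤ _ := by gcongr

theorem inner_mVec (me : ℝ) {v : E3} (hv : ‖v‖ < 1) (w : E3) :
    ⟪v, mVec me v w⟫ = gam v ^ 3 * ⟪v, w⟫ +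
      3 * me * ((phiFun ‖v‖ + ‖v‖ * deriv phiFun ‖v‖) * ⟪v, w⟫) := by
  have hg := gam_sq hv
  rcases eq_or_ne v 0 with rfl | h0
  · simp
  · have hn : ‖v‖ ≠ 0 := norm_ne_zero_iff.2 h0
    simp only [mVec, m0Vec, mfVec, inner_add_right, real_inner_smul_right,
      real_inner_self_eq_norm_sq]
    field_simp
    linear_combination (-gam v * ⟪v, w⟫) * hg

theorem le_inner_aVec (e : ℝ) {v : E3} (hv : ‖v‖ < 1) (w : E3) :
    e ^ 2 / (12 * π) * ‖w‖ ^ 2 ≤ ⟪w, aVec e v w⟫ := by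
  have hg := one_le_gam hv
  simp only [aVec, inner_add_right, real_inner_smul_right, real_inner_self_eq_norm_sq]
  gcongr
  have h1 : 1 ≤ gam v ^ 4 := one_le_pow₀ hg
  have h2 : 0 ≤ 4 * gam v ^ 6 * ⟪v, w⟫ * ⟪w, v⟫ := by
    rw [real_inner_comm v w, mul_assoc]
    exact mul_nonneg (by positivity) (mul_self_nonneg _)
  nlinarith [sq_nonneg ‖w‖]

theorem le_norm_aVec (e : ℝ) {v : E3} (hv : ‖v‖ < 1) (w : E3) :
    e ^ 2 / (12 * π) * ‖w‖ ≤ ‖aVec e v w‖ := by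
  rcases eq_or_ne w 0 with rfl | h0
  · simp
  · have hn : 0 < ‖w‖ := norm_pos_iff.2 h0
    refine le_of_mul_le_mul_left ?_ hn
    calc _ = e ^ 2 / (12 * π) * ‖w‖ ^ 2 := by ring
      _ ≤ _ := (le_inner_aVec e hv w).trans (real_inner_le_norm _ _)

theorem inner_bVec_nonneg (e : ℝ) {v : E3} (hv : ‖v‖ < 1) (w : E3) : 0 ≤ ⟪v, bVec e v w⟫ := by
  have hg := zero_le_one.trans (one_le_gam hv)
  simp only [bVec, inner_add_right, real_inner_smul_right, real_inner_self_eq_norm_sq]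
  have : 2 * gam v ^ 6 * ⟪v, w⟫ * ⟪v, w⟫ = 2 * gam v ^ 6 * ⟪v, w⟫ ^ 2 := by ring
  rw [this]
  positivity

theorem HasDerivWithinAt.aVec (e : ℝ) {u w : ℝ → E3} {w' : E3} {s : Set ℝ} {t : ℝ}
    (hu : HasDerivWithinAt u (w t) s t) (hw : HasDerivWithinAt w w' s t) (h1 : ‖u t‖ < 1) :
    HasDerivWithinAt (fun τ => aVec e (u τ) (w τ))
      (aVec e (u t) w' + (4 / 3 : ℝ) • bVec e (u t) (w t)) s t := by
  have hg := hu.gam h1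
  have hp := hu.inner ℝ hw
  refine ((((hg.fun_pow 4).fun_smul hw).fun_add
    ((((hg.fun_pow 6).const_mul 4).fun_mul hp).fun_smul hu)).fun_const_smul
      (e ^ 2 / (12 * π))).congr_deriv ?_
  simp only [_root_.aVec, bVec, real_inner_self_eq_norm_sq]
  match_scalars <;> field_simp <;> ring

theorem tendsto_zero_of_deriv_le_neg {f f' h : ℝ → ℝ} {K m : ℝ}
    (hf : ∀ t ∈ Set.Ici (0 : ℝ), HasDerivWithinAt f (f' t) (Set.Ici 0) t)
    (hle : ∀ t ∈ Set.Ici (0 : ℝ), f' t ≤ -h t) (hh : ∀ t, 0 ≤ h t) (hK : 0 ≤ K)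
    (hlip : ∀ s ∈ Set.Ici (0 : ℝ), ∀ t ∈ Set.Ici (0 : ℝ), |h t - h s| ≤ K * |t - s|)
    (hm : ∀ t ∈ Set.Ici (0 : ℝ), m ≤ f t) : Tendsto h atTop (nhds 0) := by
  have hbound : ∀ B : ℝ, ∀ s ∈ Set.Ici (0 : ℝ), ∀ t ≥ s, (∀ x ∈ Set.Ico s t, f' x ≤ B) →
      f t ≤ f s + B * (t - s) := by
    intro B s hs t hst hB
    refine image_le_of_deriv_right_le_deriv_boundary (a := s) (b := t) (f' := f')
      (B := fun x => f s + B * (x - s)) (B' := fun _ => B) ?_ ?_ ?_ ?_ ?_ hB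
      (Set.right_mem_Icc.2 hst)
    · exact fun x hx => (hf x (hs.trans hx.1)).continuousWithinAt.mono
        fun y hy => hs.trans hy.1
    · exact fun x hx => (hf x (hs.trans hx.1)).mono (Set.Ici_subset_Ici.2 (hs.trans hx.1))
    · simp
    · fun_prop
    · intro x _
      simpa using ((((hasDerivAt_id' x).sub_const s).const_mul B).const_add (f s)).hasDerivWithinAt
  have hanti : Antitone fun t => f (max 0 t) := fun s t hst => by
    have := hbound 0 (max 0 s) (Set.mem_Ici.2 (le_max_left _ _)) (max 0 t) (max_le_max le_rfl hst)
      fun x hx => (hle x ((le_max_left 0 s).trans hx.1)).trans (neg_nonpos.2 (hh x))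
    simpa using this
  have hlim := tendsto_atTop_ciInf hanti
    ⟨m, by rintro _ ⟨t, rfl⟩; exact hm _ (Set.mem_Ici.2 (le_max_left _ _))⟩
  rw [Metric.tendsto_atTop]
  intro η hη
  set δ := η / (2 * (K + 1)) with hδ
  have hδ0 : 0 < δ := by positivity
  have hKδ : K * δ < η / 2 := by
    have : (K + 1) * δ = η / 2 := by
      rw [hδ]
      field_simp
    nlinarith
  have hdiff := hlim.sub (hlim.comp (tendsto_atTop_add_const_right atTop δ tendsto_id))
  rw [sub_self] at hdiff
  have hev := (hdiff.eventually_lt_const (by positivity : 0 < δ * (η / 2))).and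
    (eventually_ge_atTop 0)
  obtain ⟨N, hN⟩ := eventually_atTop.1 hev
  refine ⟨N, fun t ht => ?_⟩
  obtain ⟨h1, h2⟩ := hN t ht
  simp only [Function.comp_apply, id, max_eq_right h2,
    max_eq_right (add_nonneg h2 hδ0.le)] at h1
  have h3 := hbound (-(h t - K * δ)) t h2 (t + δ) (by linarith) fun x hx => by
    have hx0 : (0 : ℝ) ≤ x := h2.trans hx.1
    have h4 := hlip t h2 x hx0
    have h5 : K * |x - t| ≤ K * δ := by
      gcongr
      rw [abs_of_nonneg (by linarith [hx.1])]
      linarith [hx.2]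
    linarith [hle x hx0, (abs_le.1 h4).1]
  rw [Real.dist_eq, sub_zero, abs_of_nonneg (hh t)]
  have h6 : δ * (h t - K * δ) < δ * (η / 2) := by nlinarith
  linarith [lt_of_mul_lt_mul_left h6 hδ0.le]

theorem tendsto_zero_of_deriv_sub_tendsto_zero {E : Type*} [NormedAddCommGroup E]
    [NormedSpace ℝ E] {f f' g : ℝ → E} {l : E} {K : ℝ}
    (hf : ∀ t ∈ Set.Ici (0 : ℝ), HasDerivWithinAt f (f' t) (Set.Ici 0) t)
    (hlim : Tendsto f atTop (nhds l)) (hK : 0 ≤ K)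
    (hlip : ∀ s ∈ Set.Ici (0 : ℝ), ∀ t ∈ Set.Ici (0 : ℝ), ‖g t - g s‖ ≤ K * |t - s|)
    (hfg : Tendsto (fun t => f' t - g t) atTop (nhds 0)) : Tendsto g atTop (nhds 0) := by
  rw [Metric.tendsto_atTop]
  intro η hη
  set δ := η / (3 * (K + 1)) with hδ
  have hδ0 : 0 < δ := by positivity
  have hKδ : K * δ < η / 3 := by
    have : (K + 1) * δ = η / 3 := by
      rw [hδ]
      field_simp
    nlinarith
  have hdiff := ((hlim.comp (tendsto_atTop_add_const_right atTop δ tendsto_id)).sub hlim).norm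
  rw [sub_self, norm_zero] at hdiff
  have hfg' := hfg.norm
  rw [norm_zero] at hfg'
  obtain ⟨N, hN⟩ := eventually_atTop.1 <|
    (hdiff.eventually_lt_const (by positivity : 0 < δ * (η / 3))).and <|
    (hfg'.eventually_lt_const (by positivity : 0 < η / 3)).and (eventually_ge_atTop 0)
  refine ⟨N, fun t ht => ?_⟩
  obtain ⟨h1, -, h2⟩ := hN t ht
  simp only [Function.comp_apply, id] at h1
  have h3 := norm_image_sub_le_of_norm_deriv_le_segment' (f := fun s => f s - (s - t) • g t)
    (f' := fun s => f' s - (1 : ℝ) • g t) (a := t) (b := t + δ) (C := η / 3 + K * δ)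
    (fun x hx => ((hf x (h2.trans hx.1)).mono fun y hy => h2.trans hy.1).fun_sub
      (((hasDerivAt_id' x).sub_const t).hasDerivWithinAt.smul_const (g t)))
    (fun x hx => by
      have hx0 : (0 : ℝ) ≤ x := h2.trans hx.1
      have h5 : K * |x - t| ≤ K * δ := by
        gcongr
        rw [abs_of_nonneg (by linarith [hx.1])]
        linarith [hx.2]
      calc ‖f' x - (1 : ℝ) • g t‖ = ‖(f' x - g x) + (g x - g t)‖ := by
            rw [one_smul, sub_add_sub_cancel]
        _ ≤ _ := (norm_add_le _ _).trans
          (add_le_add (hN x (ht.trans hx.1)).2.1.le ((hlip t h2 x hx0).trans h5)))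
    (t + δ) (Set.right_mem_Icc.2 (by linarith))
  simp only [add_sub_cancel_left, sub_self, zero_smul, sub_zero] at h3
  rw [dist_zero_right]
  have h4 : δ * ‖g t‖ ≤ ‖f (t + δ) - f t‖ + (η / 3 + K * δ) * δ := by
    calc δ * ‖g t‖ = ‖δ • g t‖ := by rw [norm_smul, Real.norm_of_nonneg hδ0.le]
      _ = ‖(f (t + δ) - f t) - (f (t + δ) - δ • g t - f t)‖ := by
        congr 1
        abel
      _ ≤ _ := (norm_sub_le _ _).trans (by gcongr)
  have h6 : δ * ‖g t‖ < δ * η := by nlinarith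
  exact lt_of_mul_lt_mul_left h6 hδ0.le

theorem norm_gradient_eq_norm_iteratedFDeriv_one {F : Type*} [NormedAddCommGroup F]
    [InnerProductSpace ℝ F] [CompleteSpace F] (V : F → ℝ) (q : F) :
    ‖gradient V q‖ = ‖iteratedFDeriv ℝ 1 V q‖ := by
  rw [gradient, LinearIsometryEquiv.norm_map, ← norm_iteratedFDeriv_fderiv (n := 0),
    norm_iteratedFDeriv_zero]

theorem norm_gradient_sub_le {F : Type*} [NormedAddCommGroup F]
    [InnerProductSpace ℝ F] [CompleteSpace F] {V : F → ℝ} {C : ℝ} (hV : ContDiff ℝ 2 V)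
    (hC : ∀ q, ‖iteratedFDeriv ℝ 2 V q‖ ≤ C) (p q : F) :
    ‖gradient V q - gradient V p‖ ≤ C * ‖q - p‖ := by
  rw [gradient, gradient, ← map_sub, LinearIsometryEquiv.norm_map]
  refine convex_univ.norm_image_sub_le_of_norm_fderiv_le (𝕜 := ℝ)
    (fun x _ => ((hV.fderiv_right (m := 1) (by norm_num)).differentiable one_ne_zero).differentiableAt) (fun x _ => ?_)
    (Set.mem_univ _) (Set.mem_univ _)
  rw [← norm_iteratedFDeriv_zero (𝕜 := ℝ) (f := fderiv ℝ (fderiv ℝ V)),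
    norm_iteratedFDeriv_fderiv, norm_iteratedFDeriv_fderiv]
  exact hC x

/-- for V ∈ C³ bounded below with V, ∇V, ∇²V, ∇³V bounded, any global
solution of the effective equation ṙ = u, m(u)u̇ = −∇V(r) + ε a(u)ü + ε b(u, u̇) on [0,∞)
with sup |u(t)| ≤ ū < 1 and sup |u̇(t)| ≤ c satisfies u̇ → 0, ü → 0 and ∇V(r(t)) → 0
as t → ∞. -/
theorem effective_solution_asymptotics
    (e me ε : ℝ) (he : e ≠ 0) (hme : 0 ≤ me) (hε : 0 < ε)
    (V : E3 → ℝ) (hV : ContDiff ℝ 3 V)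
    (hVbelow : BddBelow (Set.range V))
    (hVbdd : ∃ C : ℝ, ∀ q : E3, |V q| ≤ C ∧ ‖iteratedFDeriv ℝ 1 V q‖ ≤ C
      ∧ ‖iteratedFDeriv ℝ 2 V q‖ ≤ C ∧ ‖iteratedFDeriv ℝ 3 V q‖ ≤ C)
    (r u u' u'' : ℝ → E3)
    (hr : ∀ t ∈ Set.Ici (0 : ℝ), HasDerivWithinAt r (u t) (Set.Ici 0) t)
    (hu : ∀ t ∈ Set.Ici (0 : ℝ), HasDerivWithinAt u (u' t) (Set.Ici 0) t)
    (hu' : ∀ t ∈ Set.Ici (0 : ℝ), HasDerivWithinAt u' (u'' t) (Set.Ici 0) t)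
    (heq : ∀ t ∈ Set.Ici (0 : ℝ),
      mVec me (u t) (u' t)
        = -gradient V (r t) + ε • aVec e (u t) (u'' t) + ε • bVec e (u t) (u' t))
    (ubar c : ℝ) (hubar : ubar < 1)
    (hu_bd : ∀ t ∈ Set.Ici (0 : ℝ), ‖u t‖ ≤ ubar)
    (hu'_bd : ∀ t ∈ Set.Ici (0 : ℝ), ‖u' t‖ ≤ c) :
    Tendsto u' atTop (nhds 0) ∧ Tendsto u'' atTop (nhds 0)
      ∧ Tendsto (fun t => gradient V (r t)) atTop (nhds 0) := by
  have hubar0 : 0 ≤ ubar := (norm_nonneg _).trans (hu_bd 0 Set.self_mem_Ici)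
  have hc0 : 0 ≤ c := (norm_nonneg _).trans (hu'_bd 0 Set.self_mem_Ici)
  have hu1 : ∀ t ∈ Set.Ici (0 : ℝ), ‖u t‖ < 1 := fun t ht => (hu_bd t ht).trans_lt hubar
  obtain ⟨C, hC⟩ := hVbdd
  have hC0 : 0 ≤ C := (abs_nonneg _).trans (hC 0).1
  obtain ⟨Ca, hCa0, hCa⟩ := norm_aVec_le e hubar
  obtain ⟨Cb, hCb0, hCb⟩ := norm_bVec_le e hubar
  obtain ⟨Cm, hCm0, hCm⟩ := norm_mVec_le hme hubar0 hubar
  set k := e ^ 2 / (12 * π) with hk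
  have hk0 : 0 < k := by positivity
  have hεk : 0 < ε * k := mul_pos hε hk0
  have hub : ∀ᶠ t in atTop, t ∈ Set.Ici (0 : ℝ) := eventually_ge_atTop 0
  have heq' : ∀ t ∈ Set.Ici (0 : ℝ), ε • aVec e (u t) (u'' t) =
      mVec me (u t) (u' t) + gradient V (r t) - ε • bVec e (u t) (u' t) := fun t ht => by
    rw [heq t ht]
    abel
  have hu''_le : ∀ t ∈ Set.Ici (0 : ℝ), ε * k * ‖u'' t‖ ≤
      Cm * ‖u' t‖ + ‖gradient V (r t)‖ + ε * (Cb * ‖u' t‖ ^ 2) := fun t ht => by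
    calc ε * k * ‖u'' t‖ ≤ ε * ‖aVec e (u t) (u'' t)‖ := by
          rw [mul_assoc]
          gcongr
          exact le_norm_aVec e (hu1 t ht) _
      _ = ‖mVec me (u t) (u' t) + gradient V (r t) - ε • bVec e (u t) (u' t)‖ := by
          rw [← heq' t ht, norm_smul, Real.norm_of_nonneg hε.le]
      _ ≤ ‖mVec me (u t) (u' t)‖ + ‖gradient V (r t)‖ + ‖ε • bVec e (u t) (u' t)‖ :=
          (norm_sub_le _ _).trans (by gcongr; exact norm_add_le _ _)
      _ ≤ _ := by
          rw [norm_smul, Real.norm_of_nonneg hε.le]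
          gcongr
          exacts [hCm _ _ (hu_bd t ht), hCb _ _ (hu_bd t ht)]
  have hgrad_le : ∀ q, ‖gradient V q‖ ≤ C := fun q => by
    rw [norm_gradient_eq_norm_iteratedFDeriv_one]
    exact (hC q).2.1
  have haccel : ∀ t ∈ Set.Ici (0 : ℝ), HasDerivWithinAt (fun τ => aVec e (u τ) (u' τ))
      (aVec e (u t) (u'' t) + (4 / 3 : ℝ) • bVec e (u t) (u' t)) (Set.Ici 0) t :=
    fun t ht => (hu t ht).aVec e (hu' t ht) (hu1 t ht)
  have hu'_lim : Tendsto u' atTop (nhds 0) := by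
    set M := (Cm * c + C + ε * (Cb * c ^ 2)) / (ε * k) with hM
    have hM_le : ∀ t ∈ Set.Ici (0 : ℝ), ‖u'' t‖ ≤ M := fun t ht => by
      rw [hM, le_div_iff₀' hεk]
      refine (hu''_le t ht).trans ?_
      gcongr
      exacts [hu'_bd t ht, hgrad_le _, hu'_bd t ht]
    have hM0 : 0 ≤ M := (norm_nonneg _).trans (hM_le 0 Set.self_mem_Ici)
    have henergy : ∀ t ∈ Set.Ici (0 : ℝ), HasDerivWithinAt
        (fun τ => gam (u τ) + 3 * me * fieldEnergy (u τ) + V (r τ)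
          - ε * ⟪u τ, aVec e (u τ) (u' τ)⟫)
        (-(ε * (⟪u' t, aVec e (u t) (u' t)⟫ + 1 / 3 * ⟪u t, bVec e (u t) (u' t)⟫)))
        (Set.Ici 0) t := fun t ht => by
      have hVd := ((hV.differentiable (by norm_num)).differentiableAt
        (x := r t)).hasGradientAt.hasFDerivAt.comp_hasDerivWithinAt t (hr t ht)
      refine (((((hu t ht).gam (hu1 t ht)).fun_add
        (((hu t ht).fieldEnergy (hu1 t ht)).const_mul (3 * me))).fun_add hVd).fun_sub
        (((hu t ht).inner ℝ (haccel t ht)).const_mul ε)).congr_deriv ?_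
      have h := congrArg (fun x => ⟪u t, x⟫) (heq' t ht)
      simp only [inner_sub_right, inner_add_right, real_inner_smul_right,
        inner_mVec me (hu1 t ht)] at h
      simp only [InnerProductSpace.toDual_apply_apply, inner_add_right, real_inner_smul_right,
        real_inner_comm (u t) (gradient V (r t))]
      linear_combination -h
    have hsq : Tendsto (fun t => ε * k * ‖u' t‖ ^ 2) atTop (nhds 0) := by
      refine tendsto_zero_of_deriv_le_neg (K := ε * k * (2 * (c * M)))
        (m := 0 - 3 * me * (3 / (1 - ubar ^ 2)) - C - ε * (Ca * c)) henergy ?_ ?_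
        (by positivity) ?_ ?_
      · intro t ht
        have h1 := le_inner_aVec e (hu1 t ht) (u' t)
        have h2 := inner_bVec_nonneg e (hu1 t ht) (u' t)
        rw [neg_le_neg_iff, mul_assoc]
        gcongr
        linarith
      · intro t
        positivity
      · intro s hs t ht
        have hd : ∀ x ∈ Set.Ici (0 : ℝ), HasDerivWithinAt (fun τ => ‖u' τ‖ ^ 2)
          (2 * ⟪u' x, u'' x⟫) (Set.Ici 0) x := fun x hx => (hu' x hx).norm_sq
        have := (convex_Ici (0 : ℝ)).norm_image_sub_le_of_norm_hasDerivWithin_le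
          (C := 2 * (c * M)) hd (fun x hx => by
            rw [norm_mul, Real.norm_of_nonneg zero_le_two]
            gcongr
            refine (norm_inner_le_norm _ _).trans ?_
            gcongr
            exacts [hu'_bd x hx, hM_le x hx]) hs ht
        rw [← mul_sub, abs_mul, abs_of_pos hεk, mul_assoc (ε * k)]
        gcongr
        simpa using this
      · intro t ht
        have h1 := one_le_gam (hu1 t ht)
        have h2 := abs_fieldEnergy_le hubar (hu_bd t ht)
        have h3 := (abs_le.1 (hC (r t)).1).1
        have h4 : |⟪u t, aVec e (u t) (u' t)⟫| ≤ Ca * c :=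
          (norm_inner_le_of_norm_le_one (hu1 t ht).le).trans <|
            (hCa _ _ (hu_bd t ht)).trans (by gcongr; exact hu'_bd t ht)
        have h5 : ε * ⟪u t, aVec e (u t) (u' t)⟫ ≤ ε * (Ca * c) := by
          gcongr
          exact (abs_le.1 h4).2
        have hR2 : 0 < 1 - ubar ^ 2 := by nlinarith
        have h6 : |fieldEnergy (u t)| ≤ 3 / (1 - ubar ^ 2) := by
          refine h2.trans (mul_le_of_le_one_right (by positivity) ?_)
          exact pow_le_one₀ (norm_nonneg _) (hu1 t ht).le
        have h7 : 3 * me * -(3 / (1 - ubar ^ 2)) ≤ 3 * me * fieldEnergy (u t) := by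
          gcongr
          exact (abs_le.1 h6).1
        linarith
    have hsq' : Tendsto (fun t => ‖u' t‖ ^ 2) atTop (nhds 0) := by
      have := hsq.const_mul (ε * k)⁻¹
      simpa only [inv_mul_cancel_left₀ hεk.ne', mul_zero] using this
    have := hsq'.sqrt
    simp only [Real.sqrt_sq (norm_nonneg _), Real.sqrt_zero] at this
    exact tendsto_zero_iff_norm_tendsto_zero.2 this
  have hn := hu'_lim.norm
  rw [norm_zero] at hn
  have hm_lim : Tendsto (fun t => mVec me (u t) (u' t)) atTop (nhds 0) :=
    squeeze_zero_norm' (hub.mono fun t ht => hCm _ _ (hu_bd t ht)) (by simpa using hn.const_mul Cm)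
  have ha_lim : Tendsto (fun t => aVec e (u t) (u' t)) atTop (nhds 0) :=
    squeeze_zero_norm' (hub.mono fun t ht => hCa _ _ (hu_bd t ht)) (by simpa using hn.const_mul Ca)
  have hb_lim : Tendsto (fun t => bVec e (u t) (u' t)) atTop (nhds 0) :=
    squeeze_zero_norm' (hub.mono fun t ht => hCb _ _ (hu_bd t ht))
      (by simpa using (hn.pow 2).const_mul Cb)
  have hgrad_lim : Tendsto (fun t => gradient V (r t)) atTop (nhds 0) := by
    refine tendsto_zero_of_deriv_sub_tendsto_zero (K := C * ubar) (l := ε • 0)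
      (fun t ht => (haccel t ht).fun_const_smul ε) (ha_lim.const_smul ε)
      (mul_nonneg hC0 hubar0) ?_ ?_
    · intro s hs t ht
      have hlip := (convex_Ici (0 : ℝ)).norm_image_sub_le_of_norm_hasDerivWithin_le hr hu_bd hs ht
      rw [mul_assoc]
      refine (norm_gradient_sub_le (hV.of_le (by norm_num)) (fun q => (hC q).2.2.1) _ _).trans ?_
      gcongr
      exact hlip
    · have hsum := hm_lim.add (hb_lim.const_smul (ε / 3))
      rw [smul_zero, add_zero] at hsum
      refine hsum.congr' (hub.mono fun t ht => ?_)
      beta_reduce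
      rw [smul_add, heq' t ht]
      module
  refine ⟨hu'_lim, ?_, hgrad_lim⟩
  have hg := hgrad_lim.norm
  rw [norm_zero] at hg
  have hbound := ((hn.const_mul Cm).add hg).add (((hn.pow 2).const_mul Cb).const_mul ε)
  have hbound' := hbound.const_mul (ε * k)⁻¹
  exact squeeze_zero_norm' (hub.mono fun t ht => (le_inv_mul_iff₀ hεk).2 (hu''_le t ht))
    (by simpa using hbound')
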